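/- Let c ∈ ℭ_+(N) and m_1, …, m_n ∈ ℂ. Then for every r ∈ ℝ, the sublevel set {(P,Q) ∈ closure(𝔓°_+(N)) × closure(𝔓_+(N)) : J(P,Q) ≤ r} is compact. -/

import Mathlib

open Complex Finset Filter Topology

noncomputable section

/-- Coefficient space for symmetric trigonometric polynomials of degree `n`:
`(p₀, (p₁, …, pₙ))` with `p₀` real and `p₋ₖ = conj pₖ` implicit. Also used for
covariance data `c = (c₀, (c₁, …, cₙ))`. -/
abbrev Coef (n : ℕ) := ℝ × (Fin n → ℂ)

/-- The `2N`-th roots of unity `ζ_j = exp(iπj/N)`. -/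
def zet (N : ℕ) (j : ℤ) : ℂ := Complex.exp (Real.pi * Complex.I * j / N)

/-- The index set `j = -N+1, …, N`. -/
def idxs (N : ℕ) : Finset ℤ := Finset.Icc (-(N : ℤ) + 1) N

/-- Evaluation of `P(z) = Σ_{k=-n}^n p_k z^{-k}` (with `p₋ₖ = conj pₖ`). -/
def evalC {n : ℕ} (p : Coef n) (z : ℂ) : ℂ :=
  (p.1 : ℂ) + ∑ k : Fin n,
    (p.2 k * z⁻¹ ^ ((k : ℕ) + 1) + (starRingEnd ℂ) (p.2 k) * z ^ ((k : ℕ) + 1))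

/-- Real value of the symmetric trigonometric polynomial on the unit circle. -/
def evalR {n : ℕ} (p : Coef n) (z : ℂ) : ℝ := (evalC p z).re

/-- The open cone `𝔓₊(N)`. -/
def Pplus (n N : ℕ) : Set (Coef n) := {p | ∀ j ∈ idxs N, 0 < evalR p (zet N j)}

/-- The closure of `𝔓₊(N)`: `P(ζ_j) ≥ 0` for all `j`. -/
def Pnn (n N : ℕ) : Set (Coef n) := {p | ∀ j ∈ idxs N, 0 ≤ evalR p (zet N j)}

/-- The cone `𝔓₊` of trigonometric polynomials positive on the whole circle. -/
def PplusC (n : ℕ) : Set (Coef n) :=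
  {p | ∀ θ ∈ Set.Icc (-Real.pi) Real.pi, 0 < evalR p (Complex.exp (θ * Complex.I))}

/-- The closure of `𝔓₊`: nonnegative on the whole circle. -/
def PnnC (n : ℕ) : Set (Coef n) :=
  {p | ∀ θ ∈ Set.Icc (-Real.pi) Real.pi, 0 ≤ evalR p (Complex.exp (θ * Complex.I))}

/-- The pairing `⟨C,P⟩ = Σ_{k=-n}^n c_k conj(p_k)` (a real number). -/
def pairCP {n : ℕ} (c p : Coef n) : ℝ :=
  c.1 * p.1 + ∑ k : Fin n, 2 * (c.2 k * (starRingEnd ℂ) (p.2 k)).re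

/-- The open dual cone `ℭ₊(N)`. -/
def Cplus (n N : ℕ) : Set (Coef n) := {c | ∀ p ∈ Pnn n N, p ≠ 0 → 0 < pairCP c p}

/-- The open dual cone `ℭ₊`. -/
def CplusC (n : ℕ) : Set (Coef n) := {c | ∀ p ∈ PnnC n, p ≠ 0 → 0 < pairCP c p}

/-- The discrete moment `(1/(2N)) Σ_j ζ_j^k Φ(ζ_j)`. -/
def dmom (N : ℕ) (Φ : ℤ → ℝ) (k : ℤ) : ℂ :=
  (1 / (2 * (N : ℂ))) * ∑ j ∈ idxs N, zet N j ^ k * (Φ j : ℂ)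

/-- `Φ` (a function of the index `j`) satisfies the moment conditions for `c`. -/
def MomCond {n : ℕ} (N : ℕ) (c : Coef n) (Φ : ℤ → ℝ) : Prop :=
  dmom N Φ 0 = (c.1 : ℂ) ∧ ∀ k : Fin n, dmom N Φ ((k : ℕ) + 1) = c.2 k

/-- The function `j ↦ P(ζ_j)/Q(ζ_j)`. -/
def phiOf {n : ℕ} (N : ℕ) (P Q : Coef n) : ℤ → ℝ :=
  fun j => evalR P (zet N j) / evalR Q (zet N j)

/-- The dual functional `J_P(Q) = ⟨C,Q⟩ − (1/(2N)) Σ_j P(ζ_j) log Q(ζ_j)`. -/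
def JP {n : ℕ} (N : ℕ) (c P Q : Coef n) : ℝ :=
  pairCP c Q - (1 / (2 * (N : ℝ))) * ∑ j ∈ idxs N,
    evalR P (zet N j) * Real.log (evalR Q (zet N j))

/-- The moment map `F^P`, with components `F^P_k(Q) = (1/(2N)) Σ_j ζ_j^k P(ζ_j)/Q(ζ_j)`. -/
def Fmap {n : ℕ} (N : ℕ) (P Q : Coef n) : Coef n :=
  ((dmom N (phiOf N P Q) 0).re, fun k => dmom N (phiOf N P Q) ((k : ℕ) + 1))

/-- One term `P(ζ_j) log(P(ζ_j)/Q(ζ_j))` of the extended functional `J`, with the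
conventions `0·log(0/q) = 0` for `q ≥ 0` and `p·log(p/0) = +∞` for `p > 0`. -/
def Jterm (Pj Qj : ℝ) : EReal :=
  if Pj = 0 then 0 else if Qj = 0 then ⊤ else ((Pj * Real.log (Pj / Qj) : ℝ) : EReal)

/-- The extended functional
`J(P,Q) = ⟨C,Q⟩ − ⟨M,P⟩ + (1/(2N)) Σ_j P(ζ_j) log(P(ζ_j)/Q(ζ_j))`, valued in `ℝ ∪ {+∞}`. -/
def JExt {n : ℕ} (N : ℕ) (c : Coef n) (m : Fin n → ℂ) (P Q : Coef n) : EReal :=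
  ((pairCP c Q - pairCP ((0 : ℝ), m) P : ℝ) : EReal) +
    ((1 / (2 * (N : ℝ)) : ℝ) : EReal) *
      ∑ j ∈ idxs N, Jterm (evalR P (zet N j)) (evalR Q (zet N j))

/-- The domain `closure(𝔓°₊(N)) × closure(𝔓₊(N))`. -/
def DomCl (n N : ℕ) : Set (Coef n × Coef n) :=
  {PQ | PQ.1 ∈ Pnn n N ∧ PQ.1.1 = 1 ∧ PQ.2 ∈ Pnn n N}

/-- The discrete logarithmic moment `(1/(2N)) Σ_j ζ_j^k log Φ(ζ_j)`. -/
def lmom (N : ℕ) (Φ : ℤ → ℝ) (k : ℤ) : ℂ :=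
  (1 / (2 * (N : ℂ))) * ∑ j ∈ idxs N, zet N j ^ k * ((Real.log (Φ j) : ℝ) : ℂ)

/-- The entropy gain `(1/(2N)) Σ_j log Φ(ζ_j)`. -/
def entGain (N : ℕ) (Φ : ℤ → ℝ) : ℝ :=
  (1 / (2 * (N : ℝ))) * ∑ j ∈ idxs N, Real.log (Φ j)

lemma continuous_evalR {n : ℕ} (z : ℂ) : Continuous fun p : Coef n => evalR p z := by
  unfold evalR evalC
  fun_prop

lemma continuous_pairCP {n : ℕ} (c : Coef n) : Continuous fun p : Coef n => pairCP c p := by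
  unfold pairCP
  fun_prop

lemma evalR_smul {n : ℕ} (a : ℝ) (p : Coef n) (z : ℂ) : evalR (a • p) z = a * evalR p z := by
  have h : evalC (a • p) z = (a : ℂ) * evalC p z := by
    simp only [evalC, Prod.smul_fst, Prod.smul_snd, Pi.smul_apply, smul_eq_mul, real_smul,
      ofReal_mul, map_mul, conj_ofReal, mul_add, Finset.mul_sum]
    congr 1
    exact Finset.sum_congr rfl fun k _ => by ring
  rw [evalR, h, re_ofReal_mul, evalR]

lemma pairCP_smul {n : ℕ} (c : Coef n) (a : ℝ) (p : Coef n) :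
    pairCP c (a • p) = a * pairCP c p := by
  simp only [pairCP, Prod.smul_fst, Prod.smul_snd, Pi.smul_apply, smul_eq_mul, real_smul,
    map_mul, conj_ofReal, mul_add, Finset.mul_sum]
  congr 1
  · ring
  · refine Finset.sum_congr rfl fun k _ => ?_
    rw [mul_left_comm, re_ofReal_mul]
    ring

lemma isClosed_Pnn (n N : ℕ) : IsClosed (Pnn n N) := by
  simp only [Pnn, Set.ofPred_forall]
  exact isClosed_iInter fun j => isClosed_iInter fun _ =>
    isClosed_le continuous_const (continuous_evalR _)

/-- Elements of the open dual cone are coercive on the primal cone. -/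
lemma exists_mul_norm_le_pairCP {n N : ℕ} {c : Coef n} (hc : c ∈ Cplus n N) :
    ∃ ε > 0, ∀ p ∈ Pnn n N, ε * ‖p‖ ≤ pairCP c p := by
  have hK : IsCompact (Metric.sphere (0 : Coef n) 1 ∩ Pnn n N) :=
    (isCompact_sphere 0 1).inter_right (isClosed_Pnn n N)
  obtain ⟨ε, hε, h⟩ := hK.exists_forall_le' (a := 0) (continuous_pairCP c).continuousOn
    fun p hp => hc p hp.2 (ne_zero_of_mem_unit_sphere ⟨p, hp.1⟩)
  refine ⟨ε, hε, fun p hp => ?_⟩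
  rcases eq_or_ne p 0 with rfl | h0
  · simp [pairCP]
  have hn : 0 < ‖p‖ := norm_pos_iff.2 h0
  have h1 := h (‖p‖⁻¹ • p) ⟨by simp [norm_smul, hn.ne'], fun j hj => by
    rw [evalR_smul]; exact mul_nonneg (inv_nonneg.2 hn.le) (hp j hj)⟩
  rw [pairCP_smul, inv_mul_eq_div, le_div_iff₀ hn] at h1
  exact h1

lemma zet_ne_zero (N : ℕ) (j : ℤ) : zet N j ≠ 0 := Complex.exp_ne_zero _

lemma zet_zpow (N : ℕ) (j k : ℤ) : zet N j ^ k = zet N k ^ j := by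
  rw [zet, zet, ← Complex.exp_int_mul, ← Complex.exp_int_mul]
  congr 1
  ring

lemma conj_zet (N : ℕ) (j : ℤ) : (starRingEnd ℂ) (zet N j) = (zet N j)⁻¹ := by
  rw [zet, ← Complex.exp_conj, ← Complex.exp_neg]
  congr 1
  simp [neg_div]

lemma zet_ne_one {N : ℕ} {k : ℤ} (hk : k ≠ 0) (hkN : |k| < 2 * N) : zet N k ≠ 1 := by
  intro h
  have hN : (N : ℂ) ≠ 0 := by
    rintro h0
    have : N = 0 := by exact_mod_cast h0
    subst this
    have := abs_nonneg k
    simp at hkN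
    omega
  obtain ⟨l, hl⟩ := Complex.exp_eq_one_iff.1 h
  have hl' : k = 2 * N * l := by
    have hpi : (Real.pi : ℂ) ≠ 0 := by exact_mod_cast Real.pi_ne_zero
    have : (k : ℂ) = 2 * N * l := by
      field_simp at hl
      linear_combination hl
    exact_mod_cast this
  have : (2 * N : ℤ) ∣ k := ⟨l, hl'⟩
  exact hk (Int.eq_zero_of_abs_lt_dvd this hkN)

lemma card_idxs (N : ℕ) : ((idxs N).card : ℂ) = 2 * N := by
  have : (idxs N).card = 2 * N := by
    rw [idxs, Int.card_Icc]
    omega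
  rw [this]
  push_cast
  ring

lemma sum_zet_zpow {N : ℕ} {k : ℤ} (hkN : |k| < 2 * N) :
    ∑ j ∈ idxs N, zet N j ^ k = if k = 0 then 2 * (N : ℂ) else 0 := by
  split_ifs with hk
  · simp [hk, card_idxs]
  have hw := zet_ne_one hk hkN
  have hN : (N : ℂ) ≠ 0 := by
    have := abs_nonneg k
    have : N ≠ 0 := by omega
    exact_mod_cast this
  have hper : zet N k ^ (2 * N) = 1 := by
    rw [zet, ← Complex.exp_nat_mul, Complex.exp_eq_one_iff]
    exact ⟨k, by push_cast; field_simp⟩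
  have himg : idxs N = (Finset.range (2 * N)).image fun i : ℕ => (i : ℤ) + (1 - N) := by
    ext j
    simp only [idxs, Finset.mem_Icc, Finset.mem_image, Finset.mem_range]
    constructor
    · intro h
      exact ⟨(j - (1 - N)).toNat, by omega, by omega⟩
    · rintro ⟨i, hi, rfl⟩
      omega
  simp_rw [zet_zpow N _ k]
  rw [himg, Finset.sum_image fun a _ b _ h => by simpa using h]
  simp only [zpow_add₀ (zet_ne_zero N k), zpow_natCast]
  rw [← Finset.sum_mul, geom_sum_eq hw, hper]
  simp

lemma evalC_zet {n : ℕ} (p : Coef n) (N : ℕ) (j : ℤ) :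
    evalC p (zet N j) = (evalR p (zet N j) : ℂ) := by
  refine (Complex.conj_eq_iff_re.1 ?_).symm
  simp only [evalC, map_add, map_sum, map_mul, map_pow, map_inv₀, conj_zet, conj_ofReal,
    Complex.conj_conj, inv_inv]
  congr 1
  exact Finset.sum_congr rfl fun k _ => add_comm _ _

/-- Discrete Fourier inversion at the `2N`-th roots of unity. -/
lemma sum_zet_zpow_mul_evalR {n N : ℕ} (hnN : n < N) (p : Coef n) {k : ℕ} (hk : k ≤ n) :
    ∑ j ∈ idxs N, zet N j ^ k * (evalR p (zet N j) : ℂ) =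
      2 * N * ((if k = 0 then (p.1 : ℂ) else 0) +
        ∑ l : Fin n, if k = l + 1 then p.2 l else 0) := by
  have hterm : ∀ j, zet N j ^ k * (evalR p (zet N j) : ℂ) =
      p.1 * zet N j ^ (k : ℤ) + ∑ l : Fin n, (p.2 l * zet N j ^ ((k : ℤ) - (l + 1)) +
        (starRingEnd ℂ) (p.2 l) * zet N j ^ ((k : ℤ) + (l + 1))) := by
    intro j
    have hz := zet_ne_zero N j
    rw [← evalC_zet, evalC, mul_add, Finset.mul_sum]
    congr 1
    · rw [zpow_natCast, mul_comm]
    refine Finset.sum_congr rfl fun l _ => ?_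
    have h1 : zet N j ^ ((l : ℤ) + 1) = zet N j ^ ((l : ℕ) + 1) := by
      rw [← zpow_natCast]; push_cast; rfl
    rw [zpow_sub₀ hz, zpow_add₀ hz (k : ℤ), zpow_natCast, h1, inv_pow]
    field_simp
  simp_rw [hterm, Finset.sum_add_distrib]
  rw [Finset.sum_comm (s := idxs N), Finset.sum_comm (s := idxs N)]
  simp_rw [← Finset.mul_sum]
  rw [sum_zet_zpow (by rw [abs_lt]; omega)]
  have hminus : ∀ l : Fin n, ∑ j ∈ idxs N, zet N j ^ ((k : ℤ) - (l + 1)) =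
      if k = l + 1 then 2 * (N : ℂ) else 0 := fun l => by
    rw [sum_zet_zpow (by rw [abs_lt]; omega)]
    exact if_congr (by omega) rfl rfl
  have hplus : ∀ l : Fin n, ∑ j ∈ idxs N, zet N j ^ ((k : ℤ) + (l + 1)) = 0 := fun l => by
    rw [sum_zet_zpow (by rw [abs_lt]; omega), if_neg (by omega)]
  simp_rw [hminus, hplus]
  simp only [mul_zero, Finset.sum_const_zero, add_zero, mul_add, Finset.mul_sum, mul_ite,
    Nat.cast_eq_zero]
  congr 1
  · split_ifs <;> ring
  · exact Finset.sum_congr rfl fun l _ => by split_ifs <;> ring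

lemma sum_evalR {n N : ℕ} (hnN : n < N) (p : Coef n) :
    ∑ j ∈ idxs N, evalR p (zet N j) = 2 * N * p.1 := by
  have h := sum_zet_zpow_mul_evalR hnN p (Nat.zero_le n)
  simp only [pow_zero, one_mul, if_true, if_false, Finset.sum_const_zero, add_zero, (Nat.succ_ne_zero _).symm] at h
  exact_mod_cast h

lemma eq_zero_of_evalR_eq_zero {n N : ℕ} (hnN : n < N) {p : Coef n}
    (h : ∀ j ∈ idxs N, evalR p (zet N j) = 0) : p = 0 := by
  have hN : (N : ℝ) ≠ 0 := by
    have : N ≠ 0 := by omega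
    exact_mod_cast this
  refine Prod.ext ?_ (funext fun l => ?_)
  · have h0 := sum_evalR hnN p
    rw [Finset.sum_eq_zero h] at h0
    simpa [hN] using h0
  · have h1 := sum_zet_zpow_mul_evalR hnN p (k := l + 1) (by omega)
    rw [Finset.sum_eq_zero fun j hj => by rw [h j hj]; simp] at h1
    simpa [Fin.val_inj, show N ≠ 0 by omega] using h1

lemma one_zero_mem_Cplus {n N : ℕ} (hnN : n < N) : ((1, 0) : Coef n) ∈ Cplus n N := by
  intro p hp h0
  have hN : (0 : ℝ) < N := by
    have : 0 < N := by omega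
    exact_mod_cast this
  have hne : ∃ j ∈ idxs N, 0 < evalR p (zet N j) := by
    by_contra! hle
    exact h0 (eq_zero_of_evalR_eq_zero hnN fun j hj => (hle j hj).antisymm (hp j hj))
  have hpos := Finset.sum_pos' hp hne
  rw [sum_evalR hnN] at hpos
  simpa [pairCP, hN] using hpos

/-- Fenchel-Young inequality for the relative entropy. -/
lemma le_Jterm {p q : ℝ} (hp : 0 ≤ p) (hq : 0 ≤ q) (t : ℝ) :
    ((p * (1 + t) - q * Real.exp t : ℝ) : EReal) ≤ Jterm p q := by
  unfold Jterm
  split_ifs with h1 h2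
  · rw [← EReal.coe_zero, EReal.coe_le_coe_iff, h1]
    have := mul_nonneg hq (Real.exp_pos t).le
    linarith
  · exact le_top
  · rw [EReal.coe_le_coe_iff]
    have hp' : 0 < p := lt_of_le_of_ne hp (Ne.symm h1)
    have hq' : 0 < q := lt_of_le_of_ne hq (Ne.symm h2)
    have h := Real.add_one_le_exp (t - Real.log (p / q))
    rw [Real.exp_sub, Real.exp_log (div_pos hp' hq'), le_div_iff₀ (div_pos hp' hq')] at h
    have h' := mul_le_mul_of_nonneg_left h hq
    have e : q * ((t - Real.log (p / q) + 1) * (p / q)) = (t - Real.log (p / q) + 1) * p := by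
      field_simp
    rw [e] at h'
    linarith

lemma EReal.coe_finset_sum {ι : Type*} (s : Finset ι) (f : ι → ℝ) :
    ((∑ i ∈ s, f i : ℝ) : EReal) = ∑ i ∈ s, (f i : EReal) := by
  classical
  induction s using Finset.induction_on with
  | empty => simp
  | insert a s ha ih => rw [Finset.sum_insert ha, Finset.sum_insert ha, EReal.coe_add, ih]

/-- A weighted sum of relative entropies is the supremum of functions affine in `(p, q)`. -/
lemma add_mul_sum_Jterm_le_iff {ι : Type*} (s : Finset ι) {p q : ι → ℝ}
    (hp : ∀ i ∈ s, 0 ≤ p i) (hq : ∀ i ∈ s, 0 ≤ q i) (a r : ℝ) {b : ℝ} (hb : 0 < b) :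
    (a : EReal) + (b : EReal) * ∑ i ∈ s, Jterm (p i) (q i) ≤ (r : EReal) ↔
      ∀ t : ι → ℝ, a + b * ∑ i ∈ s, (p i * (1 + t i) - q i * Real.exp (t i)) ≤ r := by
  classical
  constructor
  · intro h t
    rw [← EReal.coe_le_coe_iff]
    refine le_trans ?_ h
    rw [EReal.coe_add, EReal.coe_mul, EReal.coe_finset_sum]
    exact add_le_add le_rfl (mul_le_mul_of_nonneg_left
      (Finset.sum_le_sum fun i hi => le_Jterm (hp i hi) (hq i hi) (t i))
      (EReal.coe_nonneg.2 hb.le))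
  · intro h
    have hfin : ∀ i ∈ s, p i ≠ 0 → q i ≠ 0 := by
      intro i hi hpi hqi
      have hpos : 0 < p i := lt_of_le_of_ne (hp i hi) (Ne.symm hpi)
      set A := ∑ j ∈ s.erase i, (p j - q j) with hA
      have key : ∀ x : ℝ, a + b * (p i * (1 + x) + A) ≤ r := by
        intro x
        have hx := h (Function.update 0 i x)
        rw [← Finset.add_sum_erase _ _ hi] at hx
        have hrest : ∑ j ∈ s.erase i, (p j * (1 + Function.update (0 : ι → ℝ) i x j) -
            q j * Real.exp (Function.update (0 : ι → ℝ) i x j)) = A :=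
          Finset.sum_congr rfl fun j hj => by simp [Finset.ne_of_mem_erase hj]
        rw [hrest] at hx
        simpa [hqi] using hx
      have hx := key (((r - a + 1) / b - A) / p i - 1)
      have e : a + b * (p i * (1 + (((r - a + 1) / b - A) / p i - 1)) + A) = r + 1 := by
        field_simp
        ring
      linarith
    have hJ : ∀ i ∈ s, Jterm (p i) (q i) = ((p i * Real.log (p i / q i) : ℝ) : EReal) := by
      intro i hi
      unfold Jterm
      split_ifs with h1 h2
      · simp [h1]
      · exact absurd h2 (hfin i hi h1)
      · rfl
    rw [Finset.sum_congr rfl hJ, ← EReal.coe_finset_sum, ← EReal.coe_mul, ← EReal.coe_add,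
      EReal.coe_le_coe_iff]
    let t : ℝ → ι → ℝ := fun x i => if p i = 0 then -x else Real.log (p i / q i)
    refine le_of_tendsto (x := atTop) (f := fun x : ℝ =>
      a + b * ∑ i ∈ s, (p i * (1 + t x i) - q i * Real.exp (t x i))) ?_
      (Eventually.of_forall fun x => h (t x))
    refine tendsto_const_nhds.add (tendsto_const_nhds.mul (tendsto_finsetSum _ fun i hi => ?_))
    by_cases h1 : p i = 0
    · simpa [t, h1] using (Real.tendsto_exp_neg_atTop_nhds_zero.const_mul (q i)).neg
    · have hpos : 0 < p i := lt_of_le_of_ne (hp i hi) (Ne.symm h1)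
      have hqos : 0 < q i := lt_of_le_of_ne (hq i hi) (Ne.symm (hfin i hi h1))
      have e : p i * (1 + Real.log (p i / q i)) - q i * Real.exp (Real.log (p i / q i)) =
          p i * Real.log (p i / q i) := by
        rw [Real.exp_log (div_pos hpos hqos)]
        field_simp
        ring
      simp only [t, h1, if_false, e]
      exact tendsto_const_nhds

/-- For `c ∈ ℭ₊(N)`, the sublevel sets of `J` on
`closure(𝔓°₊(N)) × closure(𝔓₊(N))` are compact. -/
theorem J_sublevel_compact
    (n N : ℕ) (hn : 1 ≤ n) (hnN : n < N)
    (c : Coef n) (hc : c ∈ Cplus n N) (m : Fin n → ℂ) (r : ℝ) :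
    IsCompact {PQ : Coef n × Coef n |
      PQ ∈ DomCl n N ∧ JExt N c m PQ.1 PQ.2 ≤ (r : EReal)} := by
  have hN : (0 : ℝ) < N := by
    have : 0 < N := by omega
    exact_mod_cast this
  have hb : (0 : ℝ) < 1 / (2 * (N : ℝ)) := by positivity
  let G : (ℤ → ℝ) → Coef n × Coef n → ℝ := fun t PQ =>
    (pairCP c PQ.2 - pairCP ((0 : ℝ), m) PQ.1) + 1 / (2 * (N : ℝ)) * ∑ j ∈ idxs N,
      (evalR PQ.1 (zet N j) * (1 + t j) - evalR PQ.2 (zet N j) * Real.exp (t j))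
  have hG : ∀ t, Continuous (G t) := fun t => by
    have h1 (z : ℂ) : Continuous fun PQ : Coef n × Coef n => evalR PQ.1 z :=
      (continuous_evalR z).comp continuous_fst
    have h2 (z : ℂ) : Continuous fun PQ : Coef n × Coef n => evalR PQ.2 z :=
      (continuous_evalR z).comp continuous_snd
    have h3 : Continuous fun PQ : Coef n × Coef n => pairCP c PQ.2 :=
      (continuous_pairCP c).comp continuous_snd
    have h4 : Continuous fun PQ : Coef n × Coef n => pairCP ((0 : ℝ), m) PQ.1 :=
      (continuous_pairCP _).comp continuous_fst
    exact (h3.sub h4).add (continuous_const.mul (continuous_finsetSum _ fun j _ =>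
      ((h1 _).mul continuous_const).sub ((h2 _).mul continuous_const)))
  have hset : {PQ : Coef n × Coef n | PQ ∈ DomCl n N ∧ JExt N c m PQ.1 PQ.2 ≤ (r : EReal)} =
      DomCl n N ∩ ⋂ t, {PQ | G t PQ ≤ r} := by
    ext PQ
    simp only [Set.mem_ofPred_eq, Set.mem_inter_iff, Set.mem_iInter]
    exact and_congr_right fun h => add_mul_sum_Jterm_le_iff _ h.1 h.2.2 _ _ hb
  have hDom : IsClosed (DomCl n N) :=
    ((isClosed_Pnn n N).preimage continuous_fst).inter
      ((isClosed_eq (continuous_fst.comp continuous_fst) continuous_const).inter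
        ((isClosed_Pnn n N).preimage continuous_snd))
  rw [hset]
  refine Metric.isCompact_of_isClosed_isBounded
    (hDom.inter (isClosed_iInter fun t => isClosed_le (hG t) continuous_const)) ?_
  obtain ⟨δ, hδ, hP⟩ := exists_mul_norm_le_pairCP (one_zero_mem_Cplus hnN)
  obtain ⟨ε, hε, hQ⟩ := exists_mul_norm_le_pairCP hc
  obtain ⟨B, hB⟩ := ((isCompact_closedBall (0 : Coef n) (1 / δ)).image
    (continuous_pairCP ((0 : ℝ), m))).bddAbove
  let T : ℝ := Real.log (ε / 2)
  refine (Metric.isBounded_closedBall (x := (0 : Coef n × Coef n))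
    (r := max (1 / δ) ((r + B - (1 + T)) / (ε / 2)))).subset ?_
  rintro ⟨P, Q⟩ ⟨⟨hP0, hP1, hQ0⟩, hGr⟩
  dsimp only at hP0 hP1 hQ0
  have hPn : ‖P‖ ≤ 1 / δ := by
    rw [le_div_iff₀ hδ, mul_comm]
    simpa [pairCP, hP1] using hP P hP0
  have hPB : pairCP ((0 : ℝ), m) P ≤ B := hB ⟨P, by simpa using hPn, rfl⟩
  have hT : G (fun _ => T) (P, Q) ≤ r := Set.mem_iInter.1 hGr _
  have hGT : G (fun _ => T) (P, Q) =
      pairCP c Q - pairCP ((0 : ℝ), m) P + ((1 + T) - Q.1 * (ε / 2)) := by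
    simp only [G, Finset.sum_sub_distrib, ← Finset.sum_mul, sum_evalR hnN, hP1, T,
      Real.exp_log (half_pos hε)]
    field_simp
  have hQ1 : Q.1 ≤ ‖Q‖ := (le_abs_self _).trans (norm_fst_le Q)
  have hQn : ‖Q‖ ≤ (r + B - (1 + T)) / (ε / 2) := by
    rw [le_div_iff₀ (half_pos hε)]
    have := hQ Q hQ0
    have := mul_le_mul_of_nonneg_right hQ1 (half_pos hε).le
    linarith
  rw [mem_closedBall_zero_iff]
  exact max_le_max hPn hQn
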